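/- Let k be a field, A a smooth k-algebra, j ≥ 1, and suppose θ₁, …, θ_d ∈ A⊗A is a regular sequence generating the diagonal ideal I. Then for every β ∈ J^j there exist unique γ₁, …, γ_d ∈ Ω^{j-1}_A and δ₁, …, δ_d ∈ Ω^j_A such that β ≡ Σ_{i=1}^d p₁^*(γ_i) ∧ dθ_i + θ_i · p₁^*(δ_i) modulo (J·J)^j in Ω^j_{A⊗A}. -/

import Mathlib

set_option maxHeartbeats 1000000
set_option synthInstance.maxHeartbeats 400000

open TensorProduct

noncomputable section

variable (k : Type) [Field k]

/-- The element `d s` of the exterior algebra `⋀_S Ω¹_{S/k}` of Kähler differentials,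
i.e. the universal derivation followed by the degree-one inclusion. -/
def dE (S : Type) [CommRing S] [Algebra k S] (s : S) :
    ExteriorAlgebra S (KaehlerDifferential k S) :=
  ExteriorAlgebra.ι S (KaehlerDifferential.D k S s)

/-- `Ω^j_{S/k}`, realized as the degree-`j` component of the exterior algebra of
`Ω¹_{S/k}`, i.e. the `j`-th power of the image of `Ω¹` in the exterior algebra. -/
def OmegaPow (S : Type) [CommRing S] [Algebra k S] (j : ℕ) :
    Submodule S (ExteriorAlgebra S (KaehlerDifferential k S)) :=
  (LinearMap.range (ExteriorAlgebra.ι S :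
    KaehlerDifferential k S →ₗ[S] ExteriorAlgebra S (KaehlerDifferential k S))) ^ j

/-- `J^j`, the degree `j` part of the differential graded ideal of `Ω^•_{S/k}` generated
by an ideal `I ⊆ S`:  `J^0 = I` (inside `Ω^0 = S`), and
`J^j = I·Ω^j + dI ∧ Ω^{j-1}` for `j ≥ 1`. -/
def Jdeg (S : Type) [CommRing S] [Algebra k S] (I : Ideal S) :
    ℕ → Submodule S (ExteriorAlgebra S (KaehlerDifferential k S))
  | 0 => I • OmegaPow k S 0
  | j + 1 =>
      I • OmegaPow k S (j + 1) ⊔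
        Submodule.span S
          {x | ∃ θ ∈ I, ∃ ε ∈ OmegaPow k S j, x = dE k S θ * ε}

/-- `(J·J)^j = Σ_{a+b=j} J^a ∧ J^b`, the degree `j` part of the square of the differential
graded ideal generated by `I`. -/
def JJdeg (S : Type) [CommRing S] [Algebra k S] (I : Ideal S) (j : ℕ) :
    Submodule S (ExteriorAlgebra S (KaehlerDifferential k S)) :=
  ⨆ p : {p : ℕ × ℕ // p.1 + p.2 = j},
    Submodule.span S
      {x | ∃ y ∈ Jdeg k S I p.1.1, ∃ z ∈ Jdeg k S I p.1.2, x = y * z}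

/-- `P` is the map `Ω^•_{S/k} → Ω^•_{T/k}` of exterior algebras of differential forms
induced by a ring homomorphism `φ : S → T` (of `k`-algebras): it is a ring homomorphism
satisfying `P(s·1) = φ(s)·1` on scalars and `P(ds) = d(φ s)` on exact one-forms.  These
two conditions determine `P` uniquely, since the exterior algebra is generated as a ring
by the scalars and the exact one-forms. -/
def IsPullback (S T : Type) [CommRing S] [CommRing T] [Algebra k S] [Algebra k T]
    (φ : S →+* T)
    (P : ExteriorAlgebra S (KaehlerDifferential k S) →+*
      ExteriorAlgebra T (KaehlerDifferential k T)) : Prop :=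
  (∀ s : S, P (algebraMap S (ExteriorAlgebra S (KaehlerDifferential k S)) s) =
    algebraMap T (ExteriorAlgebra T (KaehlerDifferential k T)) (φ s)) ∧
  (∀ s : S, P (dE k S s) = dE k T (φ s))

/-- `θ 0, θ 1, …, θ (d-1)` is a regular sequence in `B`: each `θ i` is a nonzerodivisor
modulo the ideal generated by the previous ones. -/
def IsRegSeq {B : Type*} [CommRing B] {d : ℕ} (θ : Fin d → B) : Prop :=
  ∀ i : Fin d, ∀ b : B,
    θ i * b ∈ Ideal.span (θ '' {j : Fin d | j < i}) →
      b ∈ Ideal.span (θ '' {j : Fin d | j < i})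


section Coordinates

variable {B : Type} [CommRing B]

/-- The coefficients of a relation among the members of a regular sequence lie in the ideal
generated by the sequence. -/
theorem IsRegSeq.coeff_mem_of_sum_eq_zero {d : ℕ} {θ : Fin d → B} (h : IsRegSeq θ)
    (r : Fin d → B) (hr : ∑ i, r i * θ i = 0) (i : Fin d) :
    r i ∈ Ideal.span (Set.range θ) := by
  induction d with
  | zero => exact i.elim0
  | succ n ih =>
    have himage : θ '' {l : Fin (n + 1) | l < Fin.last n} =
        Set.range fun l : Fin n => θ l.castSucc := by
      ext x
      constructor
      · rintro ⟨l, hl, rfl⟩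
        exact ⟨l.castPred hl.ne, by simp⟩
      · rintro ⟨l, rfl⟩
        exact ⟨l.castSucc, Fin.castSucc_lt_last l, rfl⟩
    have hinit : IsRegSeq fun l : Fin n => θ l.castSucc := by
      intro l b hb
      have himage' : (fun l : Fin n => θ l.castSucc) '' {m | m < l} =
          θ '' {m | m < l.castSucc} := by
        ext x
        constructor
        · rintro ⟨m, hm, rfl⟩
          exact ⟨m.castSucc, hm, rfl⟩
        · rintro ⟨m, hm, rfl⟩
          have hm' : m ≠ Fin.last n := (lt_of_lt_of_le hm (Fin.le_last _)).ne
          refine ⟨m.castPred hm', ?_, by simp⟩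
          exact hm
      rw [himage'] at hb ⊢
      exact h _ b hb
    have hle : Ideal.span (Set.range fun l : Fin n => θ l.castSucc) ≤
        Ideal.span (Set.range θ) :=
      Ideal.span_mono (by rintro _ ⟨l, rfl⟩; exact ⟨_, rfl⟩)
    rw [Fin.sum_univ_castSucc] at hr
    have hlast : r (Fin.last n) ∈ Ideal.span (Set.range fun l : Fin n => θ l.castSucc) := by
      rw [← himage]
      refine h _ _ ?_
      rw [himage, show θ (Fin.last n) * r (Fin.last n) =
        -∑ l : Fin n, r l.castSucc * θ l.castSucc by linear_combination hr]
      exact neg_mem (Ideal.sum_mem _ fun l _ =>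
        Ideal.mul_mem_left _ _ (Ideal.subset_span ⟨l, rfl⟩))
    obtain ⟨s, hs⟩ := Ideal.mem_span_range_iff_exists_fun.1 hlast
    induction i using Fin.lastCases with
    | last => exact hle hlast
    | cast l =>
      have hrel := ih hinit (fun m => r m.castSucc + s m * θ (Fin.last n)) (by
        rw [← hr, ← hs, Finset.sum_mul, ← Finset.sum_add_distrib]
        exact Finset.sum_congr rfl fun m _ => by ring) l
      exact ((Ideal.span (Set.range θ)).add_mem_iff_left
        (Ideal.mul_mem_left _ (s l) (Ideal.subset_span ⟨Fin.last n, rfl⟩))).1 (hle hrel)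

/-- The classes of a regular sequence generating `I` are linearly independent in `I / I²`. -/
theorem IsRegSeq.coeff_mem_of_sum_mem_sq {d : ℕ} {θ : Fin d → B} (h : IsRegSeq θ)
    {I : Ideal B} (hI : Ideal.span (Set.range θ) = I)
    (r : Fin d → B) (hr : ∑ i, r i * θ i ∈ I ^ 2) (i : Fin d) : r i ∈ I := by
  have hsq : ∀ x ∈ I ^ 2, ∃ s : Fin d → B, (∀ l, s l ∈ I) ∧ ∑ l, s l * θ l = x := by
    intro x hx
    rw [sq] at hx
    refine Submodule.mul_induction_on hx ?_ ?_
    · intro a ha b hb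
      rw [← hI] at hb
      obtain ⟨s, rfl⟩ := Ideal.mem_span_range_iff_exists_fun.1 hb
      refine ⟨fun l => a * s l, fun l => Ideal.mul_mem_right _ _ ha, ?_⟩
      rw [Finset.mul_sum]
      exact Finset.sum_congr rfl fun l _ => mul_assoc _ _ _
    · rintro x y ⟨s, hs, rfl⟩ ⟨t, ht, rfl⟩
      refine ⟨s + t, fun l => add_mem (hs l) (ht l), ?_⟩
      simp [add_mul, Finset.sum_add_distrib]
  obtain ⟨s, hs, hsum⟩ := hsq _ hr
  have := h.coeff_mem_of_sum_eq_zero (fun l => r l - s l)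
    (by simp [sub_mul, Finset.sum_sub_distrib, hsum]) i
  rw [hI] at this
  simpa using add_mem this (hs i)

variable {k} {A : Type} [CommRing A] [Algebra k A] [Algebra k B]

/-- If the kernel of a split surjection `μ : B → A` is generated by a regular sequence `θ`, then
`b ↦ b - p (μ b)` followed by the `i`-th coordinate of `I / I² = ⨁ A θᵢ` is a derivation
along `μ`. -/
theorem exists_coordinate_derivation (p : A →ₐ[k] B) (μ : B →ₐ[k] A)
    (hμp : ∀ a, μ (p a) = a) {d : ℕ} {θ : Fin d → B} (h : IsRegSeq θ)
    (hθ : Ideal.span (Set.range θ) = RingHom.ker μ) (i : Fin d) :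
    ∃ c : B →+ A, (∀ x y, c (x * y) = μ x * c y + μ y * c x) ∧ (∀ a, c (p a) = 0) ∧
      ∀ l, c (θ l) = if l = i then 1 else 0 := by
  classical
  have hker (b : B) : b - p (μ b) ∈ RingHom.ker μ := by simp [RingHom.mem_ker, hμp]
  have hcoeff (b : B) : ∃ r : Fin d → B, ∑ l, r l * θ l = b - p (μ b) :=
    Ideal.mem_span_range_iff_exists_fun.1 (hθ ▸ hker b)
  choose r hr using hcoeff
  have huniq (b : B) (s : Fin d → B) (hs : b - p (μ b) - ∑ l, s l * θ l ∈ RingHom.ker μ ^ 2) :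
      μ (r b i) = μ (s i) := by
    have := h.coeff_mem_of_sum_mem_sq hθ (fun l => r b l - s l)
      (by simpa [sub_mul, Finset.sum_sub_distrib, hr] using hs) i
    rw [RingHom.mem_ker, map_sub, sub_eq_zero] at this
    exact this
  refine ⟨AddMonoidHom.mk' (fun b => μ (r b i)) ?_, ?_, ?_, ?_⟩
  · intro x y
    rw [huniq (x + y) (fun l => r x l + r y l), map_add]
    simp only [add_mul, Finset.sum_add_distrib, hr, map_add]
    rw [show x + y - (p (μ x) + p (μ y)) - (x - p (μ x) + (y - p (μ y))) = 0 by ring]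
    exact zero_mem _
  · intro x y
    simp only [AddMonoidHom.mk'_apply]
    rw [huniq (x * y) (fun l => p (μ x) * r y l + p (μ y) * r x l)]
    · simp [hμp]
    · simp only [add_mul, mul_assoc, Finset.sum_add_distrib, ← Finset.mul_sum, hr, map_mul]
      rw [sq]
      convert Ideal.mul_mem_mul (hker x) (hker y) using 1
      ring
  · intro a
    simp only [AddMonoidHom.mk'_apply]
    rw [huniq (p a) 0 (by simp [hμp])]
    simp
  · intro l
    simp only [AddMonoidHom.mk'_apply]
    have hl : μ (θ l) = 0 := by
      rw [← RingHom.mem_ker, ← hθ]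
      exact Ideal.subset_span ⟨l, rfl⟩
    rw [huniq (θ l) (Pi.single l 1)]
    · by_cases hli : l = i
      · subst hli
        simp
      · simp [hli]
    · simp [hl, Pi.single_apply]

end Coordinates

section Forms

variable {k} {S : Type} [CommRing S] [Algebra k S]

theorem dE_zero : dE k S 0 = 0 := by
  simp [dE]

theorem dE_add (x y : S) : dE k S (x + y) = dE k S x + dE k S y := by
  simp [dE]

theorem dE_mul (x y : S) : dE k S (x * y) = x • dE k S y + y • dE k S x := by
  simp [dE]

theorem dE_sub (x y : S) : dE k S (x - y) = dE k S x - dE k S y := by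
  simp [dE]

theorem dE_sum {ι : Type*} (s : Finset ι) (f : ι → S) :
    dE k S (∑ i ∈ s, f i) = ∑ i ∈ s, dE k S (f i) := by
  simp [dE]

/-- A derivation along a central ring homomorphism `φ : S → R` whose values anticommute and square
to zero extends to the algebra of differential forms. -/
theorem exists_ringHom_forms {R : Type} [Ring R] (φ : S →+* R) (hφ : ∀ s x, φ s * x = x * φ s)
    (D : S →+ R) (hD : ∀ x y, D (x * y) = φ x * D y + φ y * D x)
    (hDk : ∀ t : k, D (algebraMap k S t) = 0)
    (hsq : ∀ x, D x * D x = 0) (hanti : ∀ x y, D x * D y + D y * D x = 0) :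
    ∃ Φ : ExteriorAlgebra S (KaehlerDifferential k S) →+* R,
      (∀ s, Φ (algebraMap S _ s) = φ s) ∧ ∀ s, Φ (dE k S s) = D s := by
  let : Algebra S R := φ.toAlgebra' hφ
  let : Algebra k R := (φ.comp (algebraMap k S)).toAlgebra' fun t x => hφ _ x
  have hsmul (s : S) (x : R) : s • x = φ s * x := rfl
  have hsmulk (t : k) (x : R) : t • x = φ (algebraMap k S t) * x := rfl
  have : IsScalarTower k S R := ⟨fun t s x => by
    simp [hsmul, hsmulk, Algebra.smul_def, mul_assoc]⟩
  let D' : Derivation k S R := Derivation.mk'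
    { toFun := D
      map_add' := D.map_add
      map_smul' := fun t s => by simp [Algebra.smul_def t s, hD, hDk, hsmulk] }
    (fun x y => by simp [hD, hsmul])
  let f := D'.liftKaehlerDifferential
  have hf (s : S) : f (KaehlerDifferential.D k S s) = D s := D'.liftKaehlerDifferential_comp_D s
  have hspan (m : KaehlerDifferential k S) :
      m ∈ Submodule.span S (Set.range (KaehlerDifferential.D k S)) := by
    simp [KaehlerDifferential.span_range_derivation]
  have hfanti (m n : KaehlerDifferential k S) : f m * f n + f n * f m = 0 := by
    induction hspan m using Submodule.span_induction with
    | mem m hm =>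
      obtain ⟨x, rfl⟩ := hm
      induction hspan n using Submodule.span_induction with
      | mem n hn =>
        obtain ⟨y, rfl⟩ := hn
        rw [hf, hf, hanti]
      | zero => simp
      | add a b _ _ ha hb =>
        rw [map_add, mul_add, add_mul, add_add_add_comm, ha, hb, add_zero]
      | smul s a _ ha =>
        rw [map_smul, mul_smul_comm, smul_mul_assoc, ← smul_add, ha, smul_zero]
    | zero => simp
    | add a b _ _ ha hb =>
      rw [map_add, mul_add, add_mul, add_add_add_comm, ha, hb, add_zero]
    | smul s a _ ha =>
      rw [map_smul, mul_smul_comm, smul_mul_assoc, ← smul_add, ha, smul_zero]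
  have hfsq (m : KaehlerDifferential k S) : f m * f m = 0 := by
    induction hspan m using Submodule.span_induction with
    | mem m hm =>
      obtain ⟨x, rfl⟩ := hm
      rw [hf, hsq]
    | zero => simp
    | add a b _ _ ha hb =>
      rw [map_add, mul_add, add_mul, add_mul, ha, hb, zero_add, add_zero, add_comm, hfanti]
    | smul s a _ ha =>
      rw [map_smul, mul_smul_comm, smul_mul_assoc, ha, smul_zero, smul_zero]
  refine ⟨(ExteriorAlgebra.lift S ⟨f, hfsq⟩).toRingHom, fun s => ?_, fun s => ?_⟩
  · exact (ExteriorAlgebra.lift S ⟨f, hfsq⟩).commutes s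
  · exact (ExteriorAlgebra.lift_ι_apply S f hfsq _).trans (hf s)

theorem dE_mem_OmegaPow_one (s : S) : dE k S s ∈ OmegaPow k S 1 := by
  rw [OmegaPow, pow_one]
  exact ⟨_, rfl⟩

theorem mul_mem_OmegaPow {i j : ℕ} {x y : ExteriorAlgebra S (KaehlerDifferential k S)}
    (hx : x ∈ OmegaPow k S i) (hy : y ∈ OmegaPow k S j) : x * y ∈ OmegaPow k S (i + j) := by
  rw [OmegaPow, pow_add]
  exact Submodule.mul_mem_mul hx hy

theorem dE_mul_mem_OmegaPow (s : S) {j : ℕ} {x : ExteriorAlgebra S (KaehlerDifferential k S)}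
    (hx : x ∈ OmegaPow k S j) : dE k S s * x ∈ OmegaPow k S (j + 1) :=
  add_comm 1 j ▸ mul_mem_OmegaPow (dE_mem_OmegaPow_one s) hx

theorem one_mem_OmegaPow_zero : (1 : ExteriorAlgebra S (KaehlerDifferential k S)) ∈
    OmegaPow k S 0 := by
  rw [OmegaPow, pow_zero]
  exact Submodule.one_le.1 le_rfl

theorem dE_mul_dE_comm (s t : S) : dE k S s * dE k S t = -(dE k S t * dE k S s) :=
  eq_neg_of_add_eq_zero_left (ExteriorAlgebra.ι_add_mul_swap _ _)

/-- Induction on homogeneous forms, adding one exact factor on the left at a time. -/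
theorem OmegaPow_succ_induction {j : ℕ}
    {P : ExteriorAlgebra S (KaehlerDifferential k S) → Prop}
    (hd : ∀ s, ∀ x ∈ OmegaPow k S j, P (dE k S s * x)) (hzero : P 0)
    (hadd : ∀ x y, P x → P y → P (x + y))
    {x : ExteriorAlgebra S (KaehlerDifferential k S)} (hx : x ∈ OmegaPow k S (j + 1)) : P x := by
  rw [OmegaPow, pow_succ'] at hx
  refine Submodule.mul_induction_on hx ?_ hadd
  rintro _ ⟨m, rfl⟩ y hy
  have hm : m ∈ Submodule.span S (Set.range (KaehlerDifferential.D k S)) := by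
    simp [KaehlerDifferential.span_range_derivation]
  induction hm using Submodule.span_induction generalizing y with
  | mem m hm =>
    obtain ⟨s, rfl⟩ := hm
    exact hd s y hy
  | zero => simpa using hzero
  | add a b _ _ ha hb =>
    rw [map_add, add_mul]
    exact hadd _ _ (ha y hy) (hb y hy)
  | smul s a _ ha =>
    rw [map_smul, smul_mul_assoc, ← mul_smul_comm]
    exact ha _ (Submodule.smul_mem _ s hy)

theorem dE_mul_eq (s : S) {j : ℕ} {x : ExteriorAlgebra S (KaehlerDifferential k S)}
    (hx : x ∈ OmegaPow k S j) : dE k S s * x = (-1) ^ j * (x * dE k S s) := by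
  induction j generalizing x with
  | zero =>
    rw [OmegaPow, pow_zero] at hx
    obtain ⟨b, rfl⟩ := Submodule.mem_one.1 hx
    rw [pow_zero, one_mul, Algebra.commutes]
  | succ j ih =>
    refine OmegaPow_succ_induction (P := fun x => dE k S s * x = (-1) ^ (j + 1) * (x * dE k S s))
      ?_ (by simp) ?_ hx
    · intro t y hy
      have hcomm : Commute ((-1 : ExteriorAlgebra S (KaehlerDifferential k S)) ^ j) (dE k S t) :=
        (Commute.neg_one_left _).pow_left _
      rw [← mul_assoc, dE_mul_dE_comm, neg_mul, mul_assoc, ih hy, ← mul_assoc, ← hcomm.eq,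
        pow_succ]
      simp [mul_assoc]
    · intro x y hx hy
      rw [mul_add, hx, hy, add_mul, mul_add]

theorem smul_mem_Jdeg {I : Ideal S} {t : S} (ht : t ∈ I) {j : ℕ}
    {x : ExteriorAlgebra S (KaehlerDifferential k S)} (hx : x ∈ OmegaPow k S j) :
    t • x ∈ Jdeg k S I j := by
  cases j with
  | zero => exact Submodule.smul_mem_smul ht hx
  | succ j => exact Submodule.mem_sup_left (Submodule.smul_mem_smul ht hx)

theorem dE_mul_mem_Jdeg {I : Ideal S} {t : S} (ht : t ∈ I) {j : ℕ}
    {x : ExteriorAlgebra S (KaehlerDifferential k S)} (hx : x ∈ OmegaPow k S j) :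
    dE k S t * x ∈ Jdeg k S I (j + 1) :=
  Submodule.mem_sup_right (Submodule.subset_span ⟨t, ht, x, hx, rfl⟩)

/-- Induction on the elements of `J^j`. -/
theorem Jdeg_induction {I : Ideal S} {P : ExteriorAlgebra S (KaehlerDifferential k S) → Prop}
    {j : ℕ} (hsmul : ∀ t ∈ I, ∀ x ∈ OmegaPow k S j, P (t • x))
    (hd : ∀ t ∈ I, ∀ i, i + 1 = j → ∀ x ∈ OmegaPow k S i, P (dE k S t * x))
    (hadd : ∀ x y, P x → P y → P (x + y))
    {x : ExteriorAlgebra S (KaehlerDifferential k S)} (hx : x ∈ Jdeg k S I j) : P x := by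
  have hzero : P 0 := by simpa using hsmul 0 I.zero_mem 0 (Submodule.zero_mem _)
  cases j with
  | zero => exact Submodule.smul_induction_on hx hsmul hadd
  | succ j =>
    obtain ⟨y, hy, z, hz, rfl⟩ := Submodule.mem_sup.1 hx
    refine hadd _ _ (Submodule.smul_induction_on hy hsmul hadd) ?_
    suffices ∀ s : S, P (s • z) by simpa using this 1
    clear hx
    induction hz using Submodule.span_induction with
    | mem z hz =>
      obtain ⟨t, ht, x, hx, rfl⟩ := hz
      intro s
      rw [← mul_smul_comm]
      exact hd t ht j rfl _ (Submodule.smul_mem _ s hx)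
    | zero => simpa using hzero
    | add a b _ _ ha hb => exact fun s => by simpa using hadd _ _ (ha s) (hb s)
    | smul s a _ ha => exact fun s' => by simpa [smul_smul] using ha (s' * s)

theorem dE_mul_Jdeg {I : Ideal S} (s : S) {j : ℕ}
    {x : ExteriorAlgebra S (KaehlerDifferential k S)} (hx : x ∈ Jdeg k S I j) :
    dE k S s * x ∈ Jdeg k S I (j + 1) := by
  refine Jdeg_induction (P := fun x => dE k S s * x ∈ Jdeg k S I (j + 1)) ?_ ?_ ?_ hx
  · intro t ht x hx
    rw [mul_smul_comm]
    exact smul_mem_Jdeg ht (dE_mul_mem_OmegaPow s hx)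
  · rintro t ht i rfl x hx
    rw [← mul_assoc, dE_mul_dE_comm, neg_mul, mul_assoc]
    exact neg_mem (dE_mul_mem_Jdeg ht (dE_mul_mem_OmegaPow s hx))
  · intro x y hx hy
    rw [mul_add]
    exact add_mem hx hy

theorem mul_mem_JJdeg {I : Ideal S} {a b j : ℕ} (h : a + b = j)
    {x y : ExteriorAlgebra S (KaehlerDifferential k S)}
    (hx : x ∈ Jdeg k S I a) (hy : y ∈ Jdeg k S I b) : x * y ∈ JJdeg k S I j :=
  Submodule.mem_iSup_of_mem (⟨(a, b), h⟩ : {p : ℕ × ℕ // p.1 + p.2 = j})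
    (Submodule.subset_span ⟨x, hx, y, hy, rfl⟩)

theorem smul_mem_JJdeg {I : Ideal S} {t : S} (ht : t ∈ I) {j : ℕ}
    {x : ExteriorAlgebra S (KaehlerDifferential k S)} (hx : x ∈ Jdeg k S I j) :
    t • x ∈ JJdeg k S I j := by
  rw [← one_mul x, ← smul_mul_assoc]
  exact mul_mem_JJdeg (zero_add j) (smul_mem_Jdeg ht one_mem_OmegaPow_zero) hx

theorem dE_mem_Jdeg {I : Ideal S} {t : S} (ht : t ∈ I) : dE k S t ∈ Jdeg k S I 1 := by
  simpa using dE_mul_mem_Jdeg ht one_mem_OmegaPow_zero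

/-- Induction on the elements of `(J·J)^j`. -/
theorem JJdeg_induction {I : Ideal S} {P : ExteriorAlgebra S (KaehlerDifferential k S) → Prop}
    {j : ℕ} (hmul : ∀ a b, ∀ x ∈ Jdeg k S I a, ∀ y ∈ Jdeg k S I b, P (x * y)) (hzero : P 0)
    (hadd : ∀ x y, P x → P y → P (x + y))
    {x : ExteriorAlgebra S (KaehlerDifferential k S)} (hx : x ∈ JJdeg k S I j) : P x := by
  refine Submodule.iSup_induction _ (motive := P) hx ?_ hzero hadd
  rintro ⟨⟨a, b⟩, _⟩ z hz
  suffices ∀ s : S, P (s • z) by simpa using this 1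
  change z ∈ Submodule.span S {w | ∃ x ∈ Jdeg k S I a, ∃ y ∈ Jdeg k S I b, w = x * y} at hz
  induction hz using Submodule.span_induction with
  | mem z hz =>
    obtain ⟨x, hx, y, hy, rfl⟩ := hz
    intro s
    rw [← smul_mul_assoc]
    exact hmul a b _ (Submodule.smul_mem _ s hx) _ hy
  | zero => simpa using hzero
  | add a b _ _ ha hb => exact fun s => by simpa using hadd _ _ (ha s) (hb s)
  | smul s a _ ha => exact fun s' => by simpa [smul_smul] using ha (s' * s)

/-- Two ring homomorphisms out of the differential forms agree if they agree on scalars and on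
exact one-forms. -/
theorem ringHom_forms_ext {R : Type} [Ring R]
    {f g : ExteriorAlgebra S (KaehlerDifferential k S) →+* R}
    (halg : ∀ s, f (algebraMap S _ s) = g (algebraMap S _ s))
    (hd : ∀ s, f (dE k S s) = g (dE k S s)) : f = g := by
  ext x
  induction x using ExteriorAlgebra.induction with
  | algebraMap s => exact halg s
  | ι m =>
    have hm : m ∈ Submodule.span S (Set.range (KaehlerDifferential.D k S)) := by
      simp [KaehlerDifferential.span_range_derivation]
    induction hm using Submodule.span_induction with
    | mem m hm =>
      obtain ⟨s, rfl⟩ := hm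
      exact hd s
    | zero => simp
    | add a b _ _ ha hb => simp [ha, hb]
    | smul s a _ ha => simp [Algebra.smul_def, ha, halg]
  | mul a b ha hb => simp [ha, hb]
  | add a b ha hb => simp [ha, hb]

end Forms

section Retraction

variable {k} {A B : Type} [CommRing A] [CommRing B] [Algebra k A] [Algebra k B]

/-- For a derivation `c : B → A` along `μ` killing `A`, there is an additive map picking out the
coefficient `γ` of the forms `p^*(γ) ∧ db`, and vanishing on `J·J`. -/
theorem exists_odd_coefficient (p : A →ₐ[k] B) (μ : B →ₐ[k] A) (hμp : ∀ a, μ (p a) = a)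
    {P : ExteriorAlgebra A (KaehlerDifferential k A) →+*
      ExteriorAlgebra B (KaehlerDifferential k B)}
    (hP : IsPullback k A B (p : A →+* B) P)
    (c : B →+ A) (hc : ∀ x y, c (x * y) = μ x * c y + μ y * c x) (hcp : ∀ a, c (p a) = 0) :
    ∃ G : ExteriorAlgebra B (KaehlerDifferential k B) →+
        ExteriorAlgebra A (KaehlerDifferential k A),
      (∀ t ∈ RingHom.ker μ, ∀ x, G (P x * dE k B t) = c t • x) ∧
      (∀ t ∈ RingHom.ker μ, ∀ x, G (t • x) = 0) ∧
      ∀ j, ∀ x ∈ JJdeg k B (RingHom.ker μ) j, G x = 0 := by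
  let φ : B →+* Matrix (Fin 2) (Fin 2) (ExteriorAlgebra A (KaehlerDifferential k A)) :=
    (algebraMap A (Matrix (Fin 2) (Fin 2) (ExteriorAlgebra A (KaehlerDifferential k A)))).comp
      (μ : B →+* A)
  let D : B →+ Matrix (Fin 2) (Fin 2) (ExteriorAlgebra A (KaehlerDifferential k A)) :=
    AddMonoidHom.mk' (fun b => !![dE k A (μ b), algebraMap A _ (c b); 0, -dE k A (μ b)])
      fun x y => by
        ext i j
        fin_cases i <;> fin_cases j <;> simp [dE_add, add_comm]
  have hφ (b : B) (i j : Fin 2) : φ b i j = if i = j then algebraMap A _ (μ b) else 0 := by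
    simp [φ, Matrix.algebraMap_matrix_apply]
  have hD (b : B) : D b = !![dE k A (μ b), algebraMap A _ (c b); 0, -dE k A (μ b)] := rfl
  have hdE (x y : A) : dE k A x * dE k A y + dE k A y * dE k A x = 0 :=
    ExteriorAlgebra.ι_add_mul_swap _ _
  have hdEsq (x : A) : dE k A x * dE k A x = 0 := ExteriorAlgebra.ι_sq_zero _
  have hcomm (x y : A) : dE k A y * algebraMap A _ x = algebraMap A _ x * dE k A y :=
    (Algebra.commutes x (dE k A y)).symm
  obtain ⟨Φ, hΦalg, hΦd⟩ := exists_ringHom_forms (k := k) φ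
    (fun s x => Algebra.commutes (μ s) x) D
    (fun x y => by
      ext i j
      fin_cases i <;> fin_cases j <;>
        simp [hD, hφ, Matrix.mul_apply, dE_mul, hc, Algebra.smul_def]
      abel)
    (fun t => by
      have h1 : c (algebraMap k B t) = 0 := by rw [← p.commutes, hcp]
      ext i j
      fin_cases i <;> fin_cases j <;> simp [hD, h1, dE])
    (fun x => by
      ext i j
      fin_cases i <;> fin_cases j <;>
        simp [hD, Matrix.mul_apply, Fin.sum_univ_two, hdEsq, hcomm])
    (fun x y => by
      ext i j
      fin_cases i <;> fin_cases j <;>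
        simp [hD, hdE, hcomm]
      simp only [Algebra.smul_def]
      abel)
  have hsmul (b : B) (x) : Φ (b • x) = φ b * Φ x := by
    rw [Algebra.smul_def, map_mul, hΦalg]
  have hlower (x) : Φ x 1 0 = 0 := by
    induction x using ExteriorAlgebra.induction with
    | algebraMap s => simp [hΦalg, hφ]
    | ι m =>
      have hm : m ∈ Submodule.span B (Set.range (KaehlerDifferential.D k B)) := by
        simp [KaehlerDifferential.span_range_derivation]
      induction hm using Submodule.span_induction with
      | mem m hm =>
        obtain ⟨s, rfl⟩ := hm
        change Φ (dE k B s) 1 0 = 0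
        simp [hΦd, hD]
      | zero => simp
      | add a b _ _ ha hb => simp [ha, hb]
      | smul s a _ ha => simp [hsmul, hφ, Matrix.mul_apply, ha]
    | mul a b ha hb => simp [Matrix.mul_apply, ha, hb]
    | add a b ha hb => simp [ha, hb]
  have hJ {j : ℕ} {x} (hx : x ∈ Jdeg k B (RingHom.ker μ) j) : Φ x 0 0 = 0 ∧ Φ x 1 1 = 0 := by
    refine Jdeg_induction (P := fun x => Φ x 0 0 = 0 ∧ Φ x 1 1 = 0) ?_ ?_ ?_ hx
    · intro t ht x _
      rw [RingHom.mem_ker] at ht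
      simp [hsmul, hφ, Matrix.mul_apply, ht]
    · intro t ht i _ x _
      rw [RingHom.mem_ker] at ht
      simp [hΦd, hD, Matrix.mul_apply, ht, hlower, dE_zero]
    · rintro x y ⟨hx, hx'⟩ ⟨hy, hy'⟩
      simp [hx, hx', hy, hy']
  let Φ₀ : ExteriorAlgebra B (KaehlerDifferential k B) →+*
      ExteriorAlgebra A (KaehlerDifferential k A) :=
    { toFun := fun x => Φ x 0 0
      map_one' := by simp
      map_mul' := fun x y => by simp [Matrix.mul_apply, hlower]
      map_zero' := by simp
      map_add' := fun x y => by simp }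
  have hΦP (x) : Φ (P x) 0 0 = x := by
    have : Φ₀.comp P = RingHom.id _ := by
      refine ringHom_forms_ext (k := k) (fun s => ?_) fun s => ?_
      · simp [Φ₀, hP.1, hΦalg, hφ, hμp]
      · simp [Φ₀, hP.2, hΦd, hD, hμp]
    exact congrArg (fun f => f x) this
  refine ⟨AddMonoidHom.mk' (fun x => Φ x 0 1) fun x y => by simp, ?_, ?_, ?_⟩
  · intro t ht x
    rw [RingHom.mem_ker] at ht
    simp [Matrix.mul_apply, hΦP, hΦd, hD, ht, dE_zero, Algebra.smul_def, Algebra.commutes]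
  · intro t ht x
    rw [RingHom.mem_ker] at ht
    simp [hsmul, Matrix.mul_apply, hφ, ht]
  · intro j x hx
    refine JJdeg_induction (P := fun x => Φ x 0 1 = 0) ?_ (by simp) ?_ hx
    · intro a b x hx y hy
      simp [Matrix.mul_apply, (hJ hx).1, (hJ hy).2]
    · intro x y hx hy
      simp [hx, hy]

/-- For a derivation `c : B → A` along `μ` killing `A`, there is an additive map picking out the
coefficient `δ` of the forms `b · p^*(δ)`, and vanishing on `J·J`. -/
theorem exists_even_coefficient (p : A →ₐ[k] B) (μ : B →ₐ[k] A) (hμp : ∀ a, μ (p a) = a)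
    {P : ExteriorAlgebra A (KaehlerDifferential k A) →+*
      ExteriorAlgebra B (KaehlerDifferential k B)}
    (hP : IsPullback k A B (p : A →+* B) P)
    (c : B →+ A) (hc : ∀ x y, c (x * y) = μ x * c y + μ y * c x) (hcp : ∀ a, c (p a) = 0) :
    ∃ G : ExteriorAlgebra B (KaehlerDifferential k B) →+
        ExteriorAlgebra A (KaehlerDifferential k A),
      (∀ t ∈ RingHom.ker μ, ∀ x, G (t • P x) = c t • x) ∧
      ∀ j, ∀ x ∈ JJdeg k B (RingHom.ker μ) j, G x = 0 := by
  let ι₀ : A →+* ExteriorAlgebra A (KaehlerDifferential k A) := algebraMap A _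
  let φ : B →+* DualNumber (ExteriorAlgebra A (KaehlerDifferential k A)) :=
    { toFun := fun b => TrivSqZeroExt.inl (ι₀ (μ b)) + TrivSqZeroExt.inr (ι₀ (c b))
      map_one' := by
        have h1 : c 1 = 0 := by rw [← map_one p, hcp]
        simp [h1]
      map_mul' := fun x y => by
        ext
        · simp
        · simp [hc]
          exact Algebra.commutes _ _
      map_zero' := by simp
      map_add' := fun x y => by ext <;> simp }
  let D : B →+ DualNumber (ExteriorAlgebra A (KaehlerDifferential k A)) :=
    AddMonoidHom.mk'
      (fun b => TrivSqZeroExt.inl (dE k A (μ b)) + TrivSqZeroExt.inr (dE k A (c b)))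
      fun x y => by ext <;> simp [dE_add]
  have hφ (b : B) : φ b = TrivSqZeroExt.inl (ι₀ (μ b)) + TrivSqZeroExt.inr (ι₀ (c b)) := rfl
  have hD (b : B) :
    D b = TrivSqZeroExt.inl (dE k A (μ b)) + TrivSqZeroExt.inr (dE k A (c b)) := rfl
  have hι₀ (a : A) (x) : ι₀ a * x = a • x := (Algebra.smul_def a x).symm
  have hι₀' (a : A) (x) : x * ι₀ a = a • x := by
    rw [← hι₀]
    exact (Algebra.commutes a x).symm
  have hdE (x y : A) : dE k A x * dE k A y + dE k A y * dE k A x = 0 :=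
    ExteriorAlgebra.ι_add_mul_swap _ _
  have hdEsq (x : A) : dE k A x * dE k A x = 0 := ExteriorAlgebra.ι_sq_zero _
  obtain ⟨Ψ, hΨalg, hΨd⟩ := exists_ringHom_forms (k := k) φ
    (fun s x => by ext <;> simp [hφ, hι₀, hι₀', add_comm])
    D
    (fun x y => by
      ext
      · simp [hφ, hD, hι₀, dE_mul]
      · simp [hφ, hD, hι₀, dE_add, dE_mul, hc]
        abel)
    (fun t => by
      have h1 : c (algebraMap k B t) = 0 := by rw [← p.commutes, hcp]
      simp [hD, h1, dE])
    (fun x => by ext <;> simp [hD, hdE, hdEsq])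
    (fun x y => by
      ext
      · simp [hD, hdE]
      · have h := congrArg₂ (· + ·) (hdE (μ x) (c y)) (hdE (c x) (μ y))
        simp only [add_zero] at h
        simp only [hD, TrivSqZeroExt.snd_add, TrivSqZeroExt.snd_mul, TrivSqZeroExt.fst_add,
          TrivSqZeroExt.fst_inl, TrivSqZeroExt.fst_inr, TrivSqZeroExt.snd_inl,
          TrivSqZeroExt.snd_inr, add_zero, zero_add, smul_eq_mul, MulOpposite.smul_eq_mul_unop,
          MulOpposite.unop_op, TrivSqZeroExt.snd_zero]
        rw [← h]
        abel)
  have hsmul (b : B) (x) : Ψ (b • x) = φ b * Ψ x := by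
    rw [Algebra.smul_def, map_mul, hΨalg]
  have hJ {j : ℕ} {x} (hx : x ∈ Jdeg k B (RingHom.ker μ) j) : (Ψ x).fst = 0 := by
    refine Jdeg_induction (P := fun x => (Ψ x).fst = 0) ?_ ?_ ?_ hx
    · intro t ht x _
      rw [RingHom.mem_ker] at ht
      simp [hsmul, hφ, ht]
    · intro t ht i _ x _
      rw [RingHom.mem_ker] at ht
      simp [hΨd, hD, ht, dE_zero]
    · intro x y hx hy
      simp [hx, hy]
  have hΨP (x) : (Ψ (P x)).fst = x := by
    have : ((TrivSqZeroExt.fstHom A (ExteriorAlgebra A (KaehlerDifferential k A))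
        (ExteriorAlgebra A (KaehlerDifferential k A))).toRingHom.comp Ψ).comp P =
          RingHom.id _ := by
      refine ringHom_forms_ext (k := k) (fun s => ?_) fun s => ?_
      · simp [hP.1, hΨalg, hφ, hμp, ι₀]
      · simp [hP.2, hΨd, hD, hμp]
    exact congrArg (fun f => f x) this
  refine ⟨AddMonoidHom.mk' (fun x => (Ψ x).snd) fun x y => by simp, ?_, ?_⟩
  · intro t ht x
    rw [RingHom.mem_ker] at ht
    simp [hsmul, hφ, hΨP, ht, hι₀]
  · intro j x hx
    refine JJdeg_induction (P := fun x => (Ψ x).snd = 0) ?_ (by simp) ?_ hx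
    · intro a b x hx y hy
      simp [hJ hx, hJ hy]
    · intro x y hx hy
      simp [hx, hy]

/-- Every form on `B` is congruent modulo `J` to one pulled back from `A`. -/
theorem exists_sub_pullback_mem_Jdeg (p : A →ₐ[k] B) (μ : B →ₐ[k] A) (hμp : ∀ a, μ (p a) = a)
    {P : ExteriorAlgebra A (KaehlerDifferential k A) →+*
      ExteriorAlgebra B (KaehlerDifferential k B)}
    (hP : IsPullback k A B (p : A →+* B) P) {j : ℕ}
    {x : ExteriorAlgebra B (KaehlerDifferential k B)} (hx : x ∈ OmegaPow k B j) :
    ∃ w ∈ OmegaPow k A j, x - P w ∈ Jdeg k B (RingHom.ker μ) j := by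
  have hker (b : B) : b - p (μ b) ∈ RingHom.ker μ := by simp [RingHom.mem_ker, hμp]
  induction j generalizing x with
  | zero =>
    rw [OmegaPow, pow_zero] at hx
    obtain ⟨b, rfl⟩ := Submodule.mem_one.1 hx
    refine ⟨algebraMap A _ (μ b), ?_, ?_⟩
    · rw [OmegaPow, pow_zero]
      exact Submodule.mem_one.2 ⟨_, rfl⟩
    · rw [hP.1, RingHom.coe_coe, ← map_sub, Algebra.algebraMap_eq_smul_one]
      exact smul_mem_Jdeg (hker b) one_mem_OmegaPow_zero
  | succ j ih =>
    refine OmegaPow_succ_induction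
      (P := fun x => ∃ w ∈ OmegaPow k A (j + 1), x - P w ∈ Jdeg k B (RingHom.ker μ) (j + 1))
      ?_ ⟨0, Submodule.zero_mem _, by simp⟩ ?_ hx
    · intro b x hx
      obtain ⟨w, hw, hxw⟩ := ih hx
      refine ⟨dE k A (μ b) * w, dE_mul_mem_OmegaPow _ hw, ?_⟩
      rw [map_mul, hP.2, RingHom.coe_coe,
        show dE k B b * x - dE k B (p (μ b)) * P w =
          dE k B (b - p (μ b)) * x + dE k B (p (μ b)) * (x - P w) by
            rw [dE_sub, sub_mul, mul_sub]; abel]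
      exact add_mem (dE_mul_mem_Jdeg (hker b) hx) (dE_mul_Jdeg _ hxw)
    · rintro x y ⟨v, hv, hxv⟩ ⟨w, hw, hyw⟩
      refine ⟨v + w, add_mem hv hw, ?_⟩
      rw [map_add, add_sub_add_comm]
      exact add_mem hxv hyw

/-- Modulo `J·J`, every element of `J^{j+1}` is a combination of the generators `θᵢ` and `dθᵢ` of
`J` with coefficients pulled back from `A`. -/
theorem exists_coefficients (p : A →ₐ[k] B) (μ : B →ₐ[k] A) (hμp : ∀ a, μ (p a) = a)
    {P : ExteriorAlgebra A (KaehlerDifferential k A) →+*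
      ExteriorAlgebra B (KaehlerDifferential k B)}
    (hP : IsPullback k A B (p : A →+* B) P) {d : ℕ} {θ : Fin d → B}
    (hθ : Ideal.span (Set.range θ) = RingHom.ker μ) {j : ℕ}
    {β : ExteriorAlgebra B (KaehlerDifferential k B)}
    (hβ : β ∈ Jdeg k B (RingHom.ker μ) (j + 1)) :
    ∃ γ δ : Fin d → ExteriorAlgebra A (KaehlerDifferential k A),
      (∀ i, γ i ∈ OmegaPow k A j) ∧ (∀ i, δ i ∈ OmegaPow k A (j + 1)) ∧
        β - ∑ i, (P (γ i) * dE k B (θ i) + θ i • P (δ i)) ∈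
          JJdeg k B (RingHom.ker μ) (j + 1) := by
  have hθmem (i : Fin d) : θ i ∈ RingHom.ker μ := hθ ▸ Ideal.subset_span ⟨i, rfl⟩
  let Q (β : ExteriorAlgebra B (KaehlerDifferential k B)) : Prop :=
    ∃ γ δ : Fin d → ExteriorAlgebra A (KaehlerDifferential k A),
      (∀ i, γ i ∈ OmegaPow k A j) ∧ (∀ i, δ i ∈ OmegaPow k A (j + 1)) ∧
        β - ∑ i, (P (γ i) * dE k B (θ i) + θ i • P (δ i)) ∈
          JJdeg k B (RingHom.ker μ) (j + 1)
  have hadd (x y) (hx : Q x) (hy : Q y) : Q (x + y) := by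
    obtain ⟨γ, δ, hγ, hδ, hx⟩ := hx
    obtain ⟨γ', δ', hγ', hδ', hy⟩ := hy
    refine ⟨γ + γ', δ + δ', fun i => add_mem (hγ i) (hγ' i), fun i => add_mem (hδ i) (hδ' i), ?_⟩
    convert add_mem hx hy using 1
    have hsum : ∑ i, (P ((γ + γ') i) * dE k B (θ i) + θ i • P ((δ + δ') i)) =
        ∑ i, (P (γ i) * dE k B (θ i) + θ i • P (δ i)) +
          ∑ i, (P (γ' i) * dE k B (θ i) + θ i • P (δ' i)) := by
      rw [← Finset.sum_add_distrib]
      refine Finset.sum_congr rfl fun i _ => ?_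
      simp only [Pi.add_apply, map_add, add_mul, smul_add]
      abel
    rw [hsum]
    abel
  have hsmul (t) (ht : t ∈ RingHom.ker μ) (x) (hx : x ∈ OmegaPow k B (j + 1)) : Q (t • x) := by
    rw [← hθ] at ht
    obtain ⟨r, rfl⟩ := Ideal.mem_span_range_iff_exists_fun.1 ht
    have hr (i : Fin d) := exists_sub_pullback_mem_Jdeg p μ hμp hP (Submodule.smul_mem _ (r i) hx)
    choose δ hδ hsub using hr
    refine ⟨0, δ, fun i => Submodule.zero_mem _, hδ, ?_⟩
    have : (∑ i, r i * θ i) • x -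
        ∑ i, (P ((0 : Fin d → ExteriorAlgebra A (KaehlerDifferential k A)) i) * dE k B (θ i) +
          θ i • P (δ i)) = ∑ i, θ i • (r i • x - P (δ i)) := by
      simp [Finset.sum_smul, smul_sub, smul_smul, mul_comm]
    rw [this]
    exact Submodule.sum_mem _ fun i _ => smul_mem_JJdeg (hθmem i) (hsub i)
  have hzero : Q 0 := by simpa using hsmul 0 (Ideal.zero_mem _) 0 (Submodule.zero_mem _)
  refine Jdeg_induction (P := Q) hsmul ?_ hadd hβ
  rintro t ht i hi x hx
  obtain rfl : i = j := by omega
  rw [← hθ] at ht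
  obtain ⟨r, rfl⟩ := Ideal.mem_span_range_iff_exists_fun.1 ht
  have hsplit : dE k B (∑ i, r i * θ i) * x =
      ∑ i, dE k B (θ i) * (r i • x) + ∑ i, θ i • (dE k B (r i) * x) := by
    simp [dE_sum, dE_mul, Finset.sum_add_distrib, add_mul, Finset.sum_mul]
  rw [hsplit]
  refine hadd _ _ ?_ (Finset.sum_induction _ Q hadd hzero fun l _ =>
    hsmul _ (hθmem l) _ (dE_mul_mem_OmegaPow _ hx))
  have hr (l : Fin d) := exists_sub_pullback_mem_Jdeg p μ hμp hP (Submodule.smul_mem _ (r l) hx)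
  choose w hw hsub using hr
  have hsign {T : Type} [CommRing T] [Algebra k T] {N : Submodule T
      (ExteriorAlgebra T (KaehlerDifferential k T))} {y} (hy : y ∈ N) : (-1) ^ i * y ∈ N := by
    rcases neg_one_pow_eq_or (ExteriorAlgebra T (KaehlerDifferential k T)) i with h | h <;>
      simpa [h] using hy
  refine ⟨fun l => (-1) ^ i * w l, 0, fun l => hsign (hw l), fun l => Submodule.zero_mem _, ?_⟩
  have : ∑ l, dE k B (θ l) * (r l • x) -
      ∑ l, (P ((-1) ^ i * w l) * dE k B (θ l) +
        θ l • P ((0 : Fin d → ExteriorAlgebra A (KaehlerDifferential k A)) l)) =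
      ∑ l, (-1) ^ i * ((r l • x - P (w l)) * dE k B (θ l)) := by
    rw [← Finset.sum_sub_distrib]
    refine Finset.sum_congr rfl fun l _ => ?_
    rw [dE_mul_eq _ (Submodule.smul_mem _ (r l) hx)]
    simp [sub_mul, mul_sub, mul_assoc]
  rw [this]
  exact Submodule.sum_mem _ fun l _ => hsign (mul_mem_JJdeg rfl (hsub l) (dE_mem_Jdeg (hθmem l)))

end Retraction

/-!
STATEMENT 1.
Let `k` be a field, `A` a smooth `k`-algebra (of finite presentation and formally smooth),
`j ≥ 1`, and suppose `θ₁, …, θ_d ∈ A⊗A` is a regular sequence generating the diagonal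
ideal `I`.  Then for every `β ∈ J^j` there exist unique `γ₁, …, γ_d ∈ Ω^{j-1}_A` and
`δ₁, …, δ_d ∈ Ω^j_A` such that
`β ≡ Σ_{i=1}^d p₁^*(γ_i) ∧ dθ_i + θ_i·p₁^*(δ_i)` modulo `(J·J)^j` in `Ω^j_{A⊗A}`.

Here `Ω^j` is realized as the degree-`j` part of the exterior algebra of Kähler
differentials (`OmegaPow`), `J^j` and `(J·J)^j` are the degree-`j` parts of the
differential graded ideal generated by `I` and of its square (`Jdeg`, `JJdeg`), and
`p₁^*` is the map induced on forms by `a ↦ a⊗1`, characterized by `IsPullback`.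
-/
theorem stmt1 (A : Type) [CommRing A] [Algebra k A]
    [Algebra.FormallySmooth k A] [Algebra.FinitePresentation k A]
    (j : ℕ) (hj : 1 ≤ j)
    (d : ℕ) (θ : Fin d → A ⊗[k] A) (hreg : IsRegSeq θ)
    (hgen : Ideal.span (Set.range θ) = KaehlerDifferential.ideal k A)
    (p1 : ExteriorAlgebra A (KaehlerDifferential k A) →+*
      ExteriorAlgebra (A ⊗[k] A) (KaehlerDifferential k (A ⊗[k] A)))
    (hp1 : IsPullback k A (A ⊗[k] A)
      (Algebra.TensorProduct.includeLeftRingHom : A →+* A ⊗[k] A) p1)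
    (β : ExteriorAlgebra (A ⊗[k] A) (KaehlerDifferential k (A ⊗[k] A)))
    (hβ : β ∈ Jdeg k (A ⊗[k] A) (KaehlerDifferential.ideal k A) j) :
    ∃ γ δ : Fin d → ExteriorAlgebra A (KaehlerDifferential k A),
      ((∀ i, γ i ∈ OmegaPow k A (j - 1)) ∧ (∀ i, δ i ∈ OmegaPow k A j) ∧
        β - ∑ i, (p1 (γ i) * dE k (A ⊗[k] A) (θ i) + θ i • p1 (δ i)) ∈
          JJdeg k (A ⊗[k] A) (KaehlerDifferential.ideal k A) j) ∧
      ∀ γ' δ' : Fin d → ExteriorAlgebra A (KaehlerDifferential k A),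
        (∀ i, γ' i ∈ OmegaPow k A (j - 1)) → (∀ i, δ' i ∈ OmegaPow k A j) →
        β - ∑ i, (p1 (γ' i) * dE k (A ⊗[k] A) (θ i) + θ i • p1 (δ' i)) ∈
          JJdeg k (A ⊗[k] A) (KaehlerDifferential.ideal k A) j →
        γ' = γ ∧ δ' = δ := by
  obtain ⟨j, rfl⟩ := Nat.exists_eq_add_of_le' hj
  rw [Nat.add_sub_cancel]
  let p : A →ₐ[k] A ⊗[k] A := Algebra.TensorProduct.includeLeft
  let μ : A ⊗[k] A →ₐ[k] A := Algebra.TensorProduct.lmul' k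
  have hμp (a : A) : μ (p a) = a := by simp [μ, p]
  have hP : IsPullback k A (A ⊗[k] A) (p : A →+* A ⊗[k] A) p1 := ⟨hp1.1, hp1.2⟩
  have hθ (l : Fin d) : θ l ∈ RingHom.ker μ := by
    change θ l ∈ KaehlerDifferential.ideal k A
    exact hgen ▸ Ideal.subset_span ⟨l, rfl⟩
  obtain ⟨γ, δ, hγ, hδ, h⟩ := exists_coefficients p μ hμp hP hgen hβ
  refine ⟨γ, δ, ⟨hγ, hδ, h⟩, fun γ' δ' _ _ h' => ?_⟩
  have hγγ' : γ' = γ := by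
    funext i
    obtain ⟨c, hc, hcp, hcθ⟩ := exists_coordinate_derivation p μ hμp hreg hgen i
    obtain ⟨G, hGd, hGs, hGJ⟩ := exists_odd_coefficient p μ hμp hP c hc hcp
    have key (γ δ : Fin d → ExteriorAlgebra A (KaehlerDifferential k A))
        (h : β - ∑ i, (p1 (γ i) * dE k (A ⊗[k] A) (θ i) + θ i • p1 (δ i)) ∈
          JJdeg k (A ⊗[k] A) (KaehlerDifferential.ideal k A) (j + 1)) : G β = γ i := by
      have := hGJ _ _ h
      rw [map_sub, sub_eq_zero] at this
      rw [this]
      simp [hGd _ (hθ _), hGs _ (hθ _), hcθ]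
    rw [← key γ δ h, ← key γ' δ' h']
  subst hγγ'
  refine ⟨rfl, ?_⟩
  funext i
  obtain ⟨c, hc, hcp, hcθ⟩ := exists_coordinate_derivation p μ hμp hreg hgen i
  obtain ⟨G, hGs, hGJ⟩ := exists_even_coefficient p μ hμp hP c hc hcp
  have key (δ : Fin d → ExteriorAlgebra A (KaehlerDifferential k A))
      (h : β - ∑ i, (p1 (γ' i) * dE k (A ⊗[k] A) (θ i) + θ i • p1 (δ i)) ∈
        JJdeg k (A ⊗[k] A) (KaehlerDifferential.ideal k A) (j + 1)) :
      G β = G (∑ i, p1 (γ' i) * dE k (A ⊗[k] A) (θ i)) + δ i := by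
    have := hGJ _ _ h
    rw [map_sub, sub_eq_zero] at this
    rw [this, Finset.sum_add_distrib, map_add]
    simp [hGs _ (hθ _), hcθ]
  exact add_left_cancel ((key δ' h').symm.trans (key δ h))

end
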